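/- For every constant integer k ≥ 1, if K_n → ∞, K_n²/P_n → 0, and the edge probability satisfies p_{e,q}(n) = (ln n + (k−1)·ln ln n + α_n)/n for a real sequence α_n with α_n → +∞, then the probability that the minimum degree δ_n of 𝔾_q(n,K_n,P_n,p_n) is at least k converges to 1 as n → ∞. -/

import Mathlib

open Finset Filter

/-- A configuration of the random graph `𝔾_q(n,K,P,p)`: a key-ring assignment
(one finite subset of the key pool `Fin P` per vertex) together with the
on/off states of the channels (one Boolean per unordered pair of vertices). -/
abbrev Config (n P : ℕ) : Type := (Fin n → Finset (Fin P)) × (Sym2 (Fin n) → Bool)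

/-- Probability weight of a configuration: the key rings are independent and
uniform over the `K`-element subsets of the pool of size `P`, and the channels
are independent Bernoulli(`p`). -/
noncomputable def weight (n K P : ℕ) (p : ℝ) (ω : Config n P) : ℝ :=
  (∏ i : Fin n, if (ω.1 i).card = K then ((P.choose K : ℝ))⁻¹ else 0) *
  (∏ e : Sym2 (Fin n), if ω.2 e then p else 1 - p)

/-- Probability of an event in `𝔾_q(n,K,P,p)`. -/
noncomputable def prob (n K P : ℕ) (p : ℝ) (E : Set (Config n P)) : ℝ :=
  ∑ ω : Config n P, Set.indicator E (weight n K P p) ω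

/-- Adjacency in `𝔾_q(n,K,P,p)`: two distinct vertices are adjacent iff their
key rings share at least `q` keys and the channel between them is on. -/
def Adj (q n P : ℕ) (ω : Config n P) (i j : Fin n) : Prop :=
  i ≠ j ∧ q ≤ ((ω.1 i) ∩ (ω.1 j)).card ∧ ω.2 s(i, j) = true

/-- Degree of a vertex. -/
noncomputable def degree (q n P : ℕ) (ω : Config n P) (i : Fin n) : ℕ :=
  Nat.card {j : Fin n // Adj q n P ω i j}

/-- Minimum degree of the graph. -/
noncomputable def minDeg (q n P : ℕ) (ω : Config n P) : ℕ :=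
  sInf (Set.range fun i => degree q n P ω i)

/-- `p_{s,q}`: the probability that two key rings share at least `q` keys. -/
noncomputable def psq (q K P : ℕ) : ℝ :=
  1 - ∑ u ∈ Finset.range q,
    ((K.choose u : ℝ) * ((P - K).choose (K - u) : ℝ)) / (P.choose K : ℝ)

/-- `p_{e,q}`: the probability that two distinct vertices are adjacent. -/
noncomputable def peq (q K P : ℕ) (p : ℝ) : ℝ := p * psq q K P

/-- Integrating a product of functions of distinct coordinates against a product weight. -/
lemma sum_prod_weight_mul_prod {J E B : Type*} [Fintype J] [Fintype E] [Fintype B]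
    [DecidableEq E] (f : J → E) (hf : Function.Injective f) (w : B → ℝ)
    (hw : ∑ b, w b = 1) (g : J → B → ℝ) :
    ∑ c : E → B, (∏ e, w (c e)) * ∏ j, g j (c (f j)) = ∏ j, ∑ b, w b * g j b := by
  classical
  have h1 : ∀ c : E → B, (∏ e, w (c e)) * ∏ j, g j (c (f j))
      = ∏ e, (w (c e) * ∏ j, if f j = e then g j (c e) else 1) := by
    intro c
    rw [prod_mul_distrib, Finset.prod_comm]
    congr 1
    refine prod_congr rfl fun j _ => ?_
    simp
  have h2 : ∀ e, ∑ b, (w b * ∏ j, if f j = e then g j b else 1)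
      = ∏ j, if f j = e then ∑ b, w b * g j b else 1 := by
    intro e
    by_cases he : ∃ j, f j = e
    · obtain ⟨j, rfl⟩ := he
      simp [hf.eq_iff]
    · have he' : ∀ j, f j ≠ e := fun j hj => he ⟨j, hj⟩
      simp [he', hw]
  simp_rw [h1]
  rw [← Fintype.prod_sum (fun e b => w b * ∏ j, if f j = e then g j b else 1)]
  simp_rw [h2]
  rw [Finset.prod_comm]
  simp

/-- The number of `K`-subsets meeting a given `K`-subset in exactly `u` points. -/
lemma card_inter_card_eq {P K : ℕ} (T : Finset (Fin P)) (hT : T.card = K) (u : ℕ) :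
    (univ.filter fun U : Finset (Fin P) => U.card = K ∧ (T ∩ U).card = u).card
      = K.choose u * (P - K).choose (K - u) := by
  have h : K.choose u * (P - K).choose (K - u)
      = (powersetCard u T ×ˢ powersetCard (K - u) Tᶜ).card := by
    simp [card_product, card_compl, hT]
  rw [h]
  refine card_nbij' (fun U => (T ∩ U, Tᶜ ∩ U)) (fun x => x.1 ∪ x.2) ?_ ?_ ?_ ?_
  · intro U hU
    simp only [coe_filter, mem_univ, true_and, Set.mem_ofPred_eq] at hU
    have hs : (T ∩ U).card + (Tᶜ ∩ U).card = U.card := by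
      rw [inter_comm T, inter_comm Tᶜ, ← sdiff_eq_inter_compl]
      exact card_inter_add_card_sdiff U T
    simp only [coe_product, Set.mem_prod, mem_coe, mem_powersetCard]
    exact ⟨⟨inter_subset_left, hU.2⟩, inter_subset_left, by omega⟩
  · rintro ⟨A, B⟩ hx
    simp only [coe_product, Set.mem_prod, mem_coe, mem_powersetCard] at hx
    obtain ⟨⟨hA, hAc⟩, hB, hBc⟩ := hx
    have hle := card_le_card hA
    have hTB : T ∩ B = ∅ := by
      ext x
      have := @hB x
      simp only [mem_compl] at this
      simp only [mem_inter, notMem_empty, iff_false]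
      tauto
    have hAB : Disjoint A B := by
      rw [disjoint_iff_inter_eq_empty, ← subset_empty, ← hTB]
      exact inter_subset_inter_right hA
    simp only [coe_filter, mem_univ, true_and, Set.mem_ofPred_eq]
    refine ⟨by rw [card_union_of_disjoint hAB]; omega, ?_⟩
    rw [inter_union_distrib_left, hTB, union_empty, inter_eq_right.2 hA, hAc]
  · intro U _
    ext x
    simp only [mem_union, mem_inter, mem_compl]
    tauto
  · rintro ⟨A, B⟩ hx
    simp only [coe_product, Set.mem_prod, mem_coe, mem_powersetCard] at hx
    obtain ⟨⟨hA, -⟩, hB, -⟩ := hx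
    ext x
    · have := @hA x
      have := @hB x
      simp only [mem_union, mem_inter, mem_compl] at *
      tauto
    · have := @hA x
      have := @hB x
      simp only [mem_union, mem_inter, mem_compl] at *
      tauto

lemma sum_ringWeight {P K : ℕ} (hKP : K ≤ P) :
    ∑ U : Finset (Fin P), (if U.card = K then ((P.choose K : ℝ))⁻¹ else 0) = 1 := by
  have h0 : (P.choose K : ℝ) ≠ 0 := by exact_mod_cast (Nat.choose_pos hKP).ne'
  have h : (univ.filter fun U : Finset (Fin P) => U.card = K) = powersetCard K univ := by
    ext; simp [mem_powersetCard]
  rw [← sum_filter, h]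
  simp [h0]

lemma sum_ringWeight_inter {P K : ℕ} (q : ℕ) (hKP : K ≤ P) (T : Finset (Fin P))
    (hT : T.card = K) :
    ∑ U : Finset (Fin P), (if U.card = K then ((P.choose K : ℝ))⁻¹ else 0) *
      (if q ≤ (T ∩ U).card then 1 else 0) = psq q K P := by
  have hlt : ∑ U : Finset (Fin P), (if U.card = K then ((P.choose K : ℝ))⁻¹ else 0) *
      (if (T ∩ U).card < q then 1 else 0)
      = ∑ u ∈ range q,
        ((K.choose u : ℝ) * ((P - K).choose (K - u) : ℝ)) / (P.choose K : ℝ) := by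
    have h1 : ∀ U : Finset (Fin P), (if (T ∩ U).card < q then (1 : ℝ) else 0)
        = ∑ u ∈ range q, if (T ∩ U).card = u then 1 else 0 := by
      intro U
      simp
    simp_rw [h1, mul_sum]
    rw [sum_comm]
    refine sum_congr rfl fun u _ => ?_
    rw [← Nat.cast_mul, ← card_inter_card_eq T hT u, div_eq_mul_inv]
    simp_rw [mul_ite, mul_one, mul_zero, ← ite_and]
    rw [← sum_filter, sum_const, nsmul_eq_mul]
    congr 3
    ext U
    simp [and_comm]
  rw [psq, ← hlt, eq_sub_iff_add_eq, ← sum_add_distrib]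
  refine (sum_congr rfl fun U _ => ?_).trans (sum_ringWeight hKP)
  by_cases h : q ≤ (T ∩ U).card
  · simp [h, not_lt.2 h]
  · simp [h, not_le.1 h]

/-- The neighbourhood of a fixed vertex is a binomial random subset with parameter `peq`. -/
lemma prob_neighbors_eq {q n K P : ℕ} (hKP : K ≤ P) (p : ℝ) (i : Fin n)
    (A : Finset {j : Fin n // j ≠ i}) :
    prob n K P p {ω | ∀ j : {j : Fin n // j ≠ i}, Adj q n P ω i j ↔ j ∈ A}
      = peq q K P p ^ A.card * (1 - peq q K P p) ^ (n - 1 - A.card) := by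
  classical
  set wK : Finset (Fin P) → ℝ := fun U => if U.card = K then ((P.choose K : ℝ))⁻¹ else 0
    with hwK
  set wp : Bool → ℝ := fun b => if b then p else 1 - p with hwp
  set g : Finset (Fin P) → Finset (Fin P) → {j : Fin n // j ≠ i} → Bool → ℝ :=
    fun T U j b => if ((q ≤ (T ∩ U).card ∧ b = true) ↔ j ∈ A) then 1 else 0 with hg
  set h : Finset (Fin P) → Finset (Fin P) → {j : Fin n // j ≠ i} → ℝ :=
    fun T U j => if j ∈ A then p * (if q ≤ (T ∩ U).card then 1 else 0)
      else 1 - p * (if q ≤ (T ∩ U).card then 1 else 0) with hh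
  have hgh : ∀ T U j, ∑ b, wp b * g T U j b = h T U j := by
    intro T U j
    by_cases h1 : q ≤ (T ∩ U).card <;> by_cases h2 : j ∈ A <;> simp [hwp, hg, hh, h1, h2]
  have hwsum : ∑ b, wp b = 1 := by simp [hwp]
  have hKsum : ∑ U, wK U = 1 := sum_ringWeight hKP
  have hinj : Function.Injective (fun j : {j : Fin n // j ≠ i} => s(i, (j : Fin n))) := by
    intro a b hab
    exact Subtype.ext (Sym2.congr_right.1 hab)
  have hind : ∀ ω : Config n P,
      Set.indicator {ω | ∀ j : {j : Fin n // j ≠ i}, Adj q n P ω i j ↔ j ∈ A}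
        (weight n K P p) ω
      = (∏ j, wK (ω.1 j)) * ((∏ e, wp (ω.2 e)) *
        ∏ j : {j : Fin n // j ≠ i}, g (ω.1 i) (ω.1 j) j (ω.2 s(i, (j : Fin n)))) := by
    intro ω
    have hadj : ∀ j : {j : Fin n // j ≠ i}, Adj q n P ω i j ↔
        (q ≤ (ω.1 i ∩ ω.1 j).card ∧ ω.2 s(i, (j : Fin n)) = true) := fun j => by
      simp [Adj, j.2.symm]
    rw [Set.indicator_apply]
    simp only [Set.mem_ofPred_eq, hadj, hg]
    rw [prod_boole]
    simp only [mem_univ, true_implies, weight, mul_ite, mul_one, mul_zero, hwK, hwp]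
  have hT : ∀ T, T.card = K → ∀ j, ∑ U, wK U * h T U j
      = if j ∈ A then peq q K P p else 1 - peq q K P p := by
    intro T hTK j
    have key := sum_ringWeight_inter q hKP T hTK
    have key' : ∑ U, wK U * (p * (if q ≤ (T ∩ U).card then 1 else 0)) = peq q K P p := by
      rw [peq, ← key, mul_sum]
      exact sum_congr rfl fun U _ => by simp only [hwK]; ring
    by_cases hj : j ∈ A
    · simp only [hh, hj, if_true]; exact key'
    · simp only [hh, hj, if_false, mul_sub, mul_one, sum_sub_distrib, hKsum, key']
  have hrings : ∀ S : Fin n → Finset (Fin P),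
      (∏ j, wK (S j)) * ∏ j : {j : Fin n // j ≠ i}, h (S i) (S j) j
      = ∑ T, (∏ j, wK (S j)) * ∏ j : Fin n,
        (if hj : j ≠ i then h T (S j) ⟨j, hj⟩ else if S j = T then 1 else 0) := by
    intro S
    rw [← mul_sum]
    congr 1
    have hsplit : ∀ T, ∏ j : Fin n,
        (if hj : j ≠ i then h T (S j) ⟨j, hj⟩ else if S j = T then (1 : ℝ) else 0)
        = (if S i = T then 1 else 0) * ∏ j : {j : Fin n // j ≠ i}, h T (S j) j := by
      intro T
      rw [Fintype.prod_eq_mul_prod_subtype_ne _ i]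
      congr 1
      · simp
      · exact prod_congr rfl fun j _ => by simp [j.2]
    simp_rw [hsplit]
    simp
  have hcard : Fintype.card {j : Fin n // j ≠ i} = n - 1 := by
    simp [Fintype.card_subtype_compl]
  unfold prob
  simp_rw [hind, Fintype.sum_prod_type, ← mul_sum]
  simp_rw [sum_prod_weight_mul_prod _ hinj wp hwsum, hgh, hrings]
  rw [sum_comm]
  have hfac : ∀ T, ∑ S : Fin n → Finset (Fin P), (∏ j, wK (S j)) * ∏ j : Fin n,
        (if hj : j ≠ i then h T (S j) ⟨j, hj⟩ else if S j = T then 1 else 0)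
      = wK T * (peq q K P p ^ A.card * (1 - peq q K P p) ^ (n - 1 - A.card)) := by
    intro T
    rw [sum_prod_weight_mul_prod (fun j : Fin n => j) Function.injective_id wK hKsum
      (fun j U => if hj : j ≠ i then h T U ⟨j, hj⟩ else if U = T then 1 else 0),
      Fintype.prod_eq_mul_prod_subtype_ne _ i]
    by_cases hTK : T.card = K
    · congr 1
      · simp
      · have : ∀ j : {j : Fin n // j ≠ i}, ∑ U, wK U * (if hj : (j : Fin n) ≠ i then
            h T U ⟨j, hj⟩ else if U = T then 1 else 0)
            = if j ∈ A then peq q K P p else 1 - peq q K P p := by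
          intro j
          rw [← hT T hTK j]
          exact sum_congr rfl fun U _ => by simp [j.2]
        simp_rw [this]
        rw [prod_ite, prod_const, prod_const]
        have hf : (univ.filter fun j => j ∉ A) = Aᶜ := by ext; simp
        rw [hf, card_compl, hcard]
        simp
    · have : wK T = 0 := by simp [hwK, hTK]
      simp [this]
  simp_rw [hfac]
  rw [← sum_mul, hKsum, one_mul]

lemma weight_nonneg {n K P : ℕ} {p : ℝ} (hp : p ∈ Set.Ioc (0 : ℝ) 1) (ω : Config n P) :
    0 ≤ weight n K P p ω := by
  refine mul_nonneg (prod_nonneg fun j _ => ?_) (prod_nonneg fun e _ => ?_)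
  · split_ifs <;> positivity
  · split_ifs
    · exact hp.1.le
    · linarith [hp.2]

lemma sum_weight {n K P : ℕ} (hKP : K ≤ P) (p : ℝ) :
    ∑ ω : Config n P, weight n K P p ω = 1 := by
  set wK : Finset (Fin P) → ℝ := fun U => if U.card = K then ((P.choose K : ℝ))⁻¹ else 0
  set wp : Bool → ℝ := fun b => if b then p else 1 - p with hwp
  have hw : ∀ ω : Config n P, weight n K P p ω = (∏ j, wK (ω.1 j)) * ∏ e, wp (ω.2 e) :=
    fun _ => rfl
  have hwsum : ∑ b, wp b = 1 := by simp [hwp]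
  have hKsum : ∑ U, wK U = 1 := sum_ringWeight hKP
  simp_rw [hw, Fintype.sum_prod_type, ← mul_sum]
  rw [← Fintype.prod_sum (fun (_ : Sym2 (Fin n)) b => wp b), ← sum_mul,
    ← Fintype.prod_sum (fun (_ : Fin n) U => wK U)]
  simp only [hwsum, hKsum, prod_const_one, mul_one]

lemma prob_le_one {n K P : ℕ} (hKP : K ≤ P) {p : ℝ} (hp : p ∈ Set.Ioc (0 : ℝ) 1)
    (E : Set (Config n P)) : prob n K P p E ≤ 1 := by
  rw [← sum_weight hKP p]
  exact sum_le_sum fun ω _ => Set.indicator_le_self' (fun _ _ => weight_nonneg hp _) ω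

/-- Union bound over all vertices and all small neighbourhoods. -/
lemma one_sub_prob_le {q n K P : ℕ} (hn : 1 ≤ n) (hKP : K ≤ P) {p : ℝ}
    (hp : p ∈ Set.Ioc (0 : ℝ) 1) (k : ℕ) :
    1 - prob n K P p {ω | k ≤ minDeg q n P ω} ≤
      n * ∑ m ∈ range n, if m < k then ((n - 1).choose m : ℝ) *
        (peq q K P p ^ m * (1 - peq q K P p) ^ (n - 1 - m)) else 0 := by
  classical
  set Ev : (i : Fin n) → Finset {j : Fin n // j ≠ i} → Set (Config n P) := fun i A =>
    {ω | ∀ j : {j : Fin n // j ≠ i}, Adj q n P ω i j ↔ j ∈ A} with hEv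
  have hcover : ∀ ω : Config n P, ¬ k ≤ minDeg q n P ω →
      ∃ i, ∃ A : Finset {j : Fin n // j ≠ i}, A.card < k ∧ ω ∈ Ev i A := by
    intro ω hω
    have : Nonempty (Fin n) := ⟨⟨0, hn⟩⟩
    have hmem : minDeg q n P ω ∈ Set.range fun i => degree q n P ω i :=
      Nat.sInf_mem (Set.range_nonempty _)
    obtain ⟨i, hi⟩ := hmem
    refine ⟨i, univ.filter fun j => Adj q n P ω i j, ?_, by simp [hEv]⟩
    have hdeg : (univ.filter fun j : {j : Fin n // j ≠ i} => Adj q n P ω i j).card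
        = degree q n P ω i := by
      rw [degree, Nat.card_eq_fintype_card, Fintype.card_subtype]
      refine card_bij (fun j _ => (j : Fin n)) (by simp) (by simp) ?_
      intro j hj
      simp only [mem_filter, mem_univ, true_and] at hj
      exact ⟨⟨j, hj.1.symm⟩, by simpa using hj, rfl⟩
    simp only at hi
    omega
  have hpt : ∀ ω : Config n P, weight n K P p ω
      - Set.indicator {ω | k ≤ minDeg q n P ω} (weight n K P p) ω
      ≤ ∑ i, ∑ A : Finset {j : Fin n // j ≠ i},
        if A.card < k then Set.indicator (Ev i A) (weight n K P p) ω else 0 := by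
    intro ω
    have hnn : ∀ i, ∀ A : Finset {j : Fin n // j ≠ i},
        0 ≤ if A.card < k then Set.indicator (Ev i A) (weight n K P p) ω else 0 := by
      intro i A
      split_ifs
      · exact Set.indicator_nonneg (fun _ _ => weight_nonneg hp _) _
      · exact le_rfl
    by_cases hω : k ≤ minDeg q n P ω
    · rw [Set.indicator_of_mem (by exact hω), sub_self]
      exact sum_nonneg fun i _ => sum_nonneg fun A _ => hnn i A
    · rw [Set.indicator_of_notMem (by exact hω), sub_zero]
      obtain ⟨i, A, hA, hmem⟩ := hcover ω hω
      refine le_trans ?_ (single_le_sum (f := fun i => ∑ A : Finset {j : Fin n // j ≠ i},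
        if A.card < k then Set.indicator (Ev i A) (weight n K P p) ω else 0)
        (fun i _ => sum_nonneg fun A _ => hnn i A) (mem_univ i))
      refine le_trans ?_ (single_le_sum (fun A _ => hnn i A) (mem_univ A))
      rw [if_pos hA, Set.indicator_of_mem hmem]
  calc 1 - prob n K P p {ω | k ≤ minDeg q n P ω}
      = ∑ ω : Config n P, (weight n K P p ω
        - Set.indicator {ω | k ≤ minDeg q n P ω} (weight n K P p) ω) := by
        rw [sum_sub_distrib, sum_weight hKP, prob]
    _ ≤ ∑ ω : Config n P, ∑ i, ∑ A : Finset {j : Fin n // j ≠ i},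
        (if A.card < k then Set.indicator (Ev i A) (weight n K P p) ω else 0) :=
        sum_le_sum fun ω _ => hpt ω
    _ = ∑ i : Fin n, ∑ A : Finset {j : Fin n // j ≠ i},
        (if A.card < k then prob n K P p (Ev i A) else 0) := by
        rw [sum_comm]
        refine sum_congr rfl fun i _ => ?_
        rw [sum_comm]
        refine sum_congr rfl fun A _ => ?_
        split_ifs
        · rfl
        · simp
    _ = ∑ _i : Fin n, ∑ m ∈ range n, (if m < k then ((n - 1).choose m : ℝ) *
        (peq q K P p ^ m * (1 - peq q K P p) ^ (n - 1 - m)) else 0) := by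
        refine sum_congr rfl fun i _ => ?_
        simp_rw [hEv, prob_neighbors_eq hKP]
        have := sum_powerset_apply_card (f := fun m => if m < k then
          (peq q K P p ^ m * (1 - peq q K P p) ^ (n - 1 - m)) else 0)
          (x := (univ : Finset {j : Fin n // j ≠ i}))
        rw [powerset_univ] at this
        rw [this]
        have hcard : Fintype.card {j : Fin n // j ≠ i} = n - 1 := by
          simp [Fintype.card_subtype_compl]
        rw [card_univ, hcard, Nat.sub_add_cancel hn]
        refine sum_congr rfl fun m _ => ?_
        simp
    _ = _ := by simp

lemma peq_le_one {q K P : ℕ} {p : ℝ} (hp : p ∈ Set.Ioc (0 : ℝ) 1) : peq q K P p ≤ 1 := by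
  have : psq q K P ≤ 1 := by
    rw [psq]
    have : 0 ≤ ∑ u ∈ Finset.range q,
      ((K.choose u : ℝ) * ((P - K).choose (K - u) : ℝ)) / (P.choose K : ℝ) :=
      sum_nonneg fun u _ => by positivity
    linarith
  calc p * psq q K P ≤ p * 1 := mul_le_mul_of_nonneg_left this hp.1.le
    _ ≤ 1 := by linarith [hp.2]

/-- Poisson-type bound for a binomial point mass. -/
lemma choose_mul_pow_le {n k m : ℕ} (hm : m < k) (hmn : m < n) {x : ℝ} (hx0 : 0 ≤ x)
    (hx1 : x ≤ 1) :
    ((n - 1).choose m : ℝ) * (x ^ m * (1 - x) ^ (n - 1 - m))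
      ≤ Real.exp k * ((n * x) ^ m * Real.exp (-(n * x))) := by
  have h1 : ((n - 1).choose m : ℝ) ≤ (n : ℝ) ^ m := by
    exact_mod_cast (Nat.choose_le_pow (n - 1) m).trans (Nat.pow_le_pow_left (Nat.sub_le n 1) m)
  have h2 : (1 - x) ^ (n - 1 - m) ≤ Real.exp k * Real.exp (-(n * x)) := by
    calc (1 - x) ^ (n - 1 - m) ≤ Real.exp (-x) ^ (n - 1 - m) :=
          pow_le_pow_left₀ (by linarith) (Real.one_sub_le_exp_neg x) _
      _ = Real.exp (((n - 1 - m : ℕ) : ℝ) * (-x)) := by rw [Real.exp_nat_mul]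
      _ ≤ Real.exp k * Real.exp (-(n * x)) := by
          rw [← Real.exp_add, Real.exp_le_exp]
          have e : ((n - 1 - m : ℕ) : ℝ) = n - (m + 1) := by
            rw [Nat.sub_sub, add_comm, Nat.cast_sub (by omega)]; push_cast; ring
          rw [e]
          have : (m : ℝ) + 1 ≤ k := by exact_mod_cast hm
          nlinarith
  calc ((n - 1).choose m : ℝ) * (x ^ m * (1 - x) ^ (n - 1 - m))
      ≤ (n : ℝ) ^ m * (x ^ m * (Real.exp k * Real.exp (-(n * x)))) := by
        have : 0 ≤ (1 - x) ^ (n - 1 - m) := pow_nonneg (by linarith) _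
        gcongr
    _ = _ := by rw [mul_pow]; ring

/-- The Poisson bound at the critical edge probability. -/
lemma critical_bound {n k m : ℕ} (hm : m < k) (hlog : 1 ≤ Real.log n) {a y : ℝ}
    (ha : 0 ≤ a)
    (hy : y = Real.log n + ((k : ℝ) - 1) * Real.log (Real.log n) + a) :
    n * (y ^ m * Real.exp (-y)) ≤ (k + a) ^ (k - 1) * Real.exp (-a) := by
  set L := Real.log n with hL
  have hn : (0 : ℝ) < n := by
    rcases Nat.eq_zero_or_pos n with h | h
    · simp [hL, h] at hlog; linarith
    · exact_mod_cast h
  have hk : 1 ≤ k := by omega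
  have hL0 : 0 < L := by linarith
  have hk1 : (0 : ℝ) ≤ (k : ℝ) - 1 := by
    have : (1 : ℝ) ≤ k := by exact_mod_cast hk
    linarith
  have hll : 0 ≤ Real.log L := Real.log_nonneg hlog
  have hll' : Real.log L ≤ L := (Real.log_le_sub_one_of_pos hL0).trans (by linarith)
  have hy1 : 1 ≤ y := by nlinarith [mul_nonneg hk1 hll]
  have hyL : y ≤ (k + a) * L := by nlinarith [mul_le_mul_of_nonneg_left hll' hk1]
  have hexp : Real.exp (-y) = (n : ℝ)⁻¹ * (L ^ (k - 1))⁻¹ * Real.exp (-a) := by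
    have hc : ((k - 1 : ℕ) : ℝ) = (k : ℝ) - 1 := by rw [Nat.cast_sub hk]; simp
    rw [hy, neg_add, neg_add, Real.exp_add, Real.exp_add, Real.exp_neg L, hL,
      Real.exp_log hn, ← hL, Real.exp_neg (_ * _), ← hc, Real.exp_nat_mul, Real.exp_log hL0]
  calc n * (y ^ m * Real.exp (-y)) ≤ n * (((k + a) * L) ^ (k - 1) * Real.exp (-y)) := by
        gcongr
        calc y ^ m ≤ y ^ (k - 1) := pow_le_pow_right₀ hy1 (by omega)
          _ ≤ _ := by gcongr
    _ = (k + a) ^ (k - 1) * Real.exp (-a) := by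
        rw [hexp, mul_pow]
        field_simp

lemma tendsto_const_add_pow_mul_exp_neg (c : ℝ) (d : ℕ) :
    Tendsto (fun a : ℝ => (c + a) ^ d * Real.exp (-a)) atTop (nhds 0) := by
  have h := (Real.tendsto_pow_mul_exp_neg_atTop_nhds_zero d).comp
    (tendsto_atTop_add_const_left atTop c tendsto_id)
  have h2 := h.const_mul (Real.exp c)
  rw [mul_zero] at h2
  refine h2.congr fun a => ?_
  simp only [Function.comp, id, neg_add, Real.exp_add, Real.exp_neg c]
  field_simp

/-- if `K_n → ∞`, `K_n²/P_n → 0` and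
`p_{e,q}(n) = (ln n + (k−1) ln ln n + α_n)/n` with `α_n → +∞`, then
`P[min degree of 𝔾_q(n,K_n,P_n,p_n) ≥ k] → 1`. -/
theorem min_degree_atLeast_k_prob_one_limit
    (q : ℕ) (hq : 1 ≤ q) (k : ℕ) (hk : 1 ≤ k)
    (K P : ℕ → ℕ) (p : ℕ → ℝ) (α : ℕ → ℝ)
    (hK1 : ∀ n, 1 ≤ K n) (hKP : ∀ n, K n ≤ P n)
    (hp : ∀ n, p n ∈ Set.Ioc (0 : ℝ) 1)
    (hKinf : Tendsto (fun n => (K n : ℝ)) atTop atTop)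
    (hKsqP : Tendsto (fun n => ((K n : ℝ)) ^ 2 / (P n : ℝ)) atTop (nhds 0))
    (hpe : ∀ n : ℕ, peq q (K n) (P n) (p n)
      = (Real.log (n : ℝ) + ((k : ℝ) - 1) * Real.log (Real.log (n : ℝ)) + α n) / (n : ℝ))
    (hα : Tendsto α atTop atTop) :
    Tendsto (fun n => prob n (K n) (P n) (p n) {ω | k ≤ minDeg q n (P n) ω})
      atTop (nhds 1) := by
  set F : ℝ → ℝ := fun a =>
    (k : ℝ) * (Real.exp k * (((k : ℝ) + a) ^ (k - 1) * Real.exp (-a))) with hF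
  have hF0 : Tendsto (fun n => F (α n)) atTop (nhds 0) := by
    have h := ((tendsto_const_add_pow_mul_exp_neg (k : ℝ) (k - 1)).const_mul
      (Real.exp k)).const_mul (k : ℝ)
    rw [mul_zero, mul_zero] at h
    exact h.comp hα
  have hlog : ∀ᶠ n : ℕ in atTop, 1 ≤ Real.log (n : ℝ) :=
    (Real.tendsto_log_atTop.comp tendsto_natCast_atTop_atTop).eventually_ge_atTop 1
  have hlow : ∀ᶠ n : ℕ in atTop,
      1 - F (α n) ≤ prob n (K n) (P n) (p n) {ω | k ≤ minDeg q n (P n) ω} := by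
    filter_upwards [hlog, hα.eventually_ge_atTop 0, eventually_ge_atTop 1] with n hl ha hn
    have hn0 : (0 : ℝ) < n := by exact_mod_cast hn
    have hk1 : (0 : ℝ) ≤ (k : ℝ) - 1 := by
      have : (1 : ℝ) ≤ k := by exact_mod_cast hk
      linarith
    have hy : (n : ℝ) * peq q (K n) (P n) (p n)
        = Real.log n + ((k : ℝ) - 1) * Real.log (Real.log n) + α n := by
      rw [hpe n]; field_simp
    have hx0 : 0 ≤ peq q (K n) (P n) (p n) := by
      have := mul_nonneg hk1 (Real.log_nonneg hl)
      rw [hpe n]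
      exact div_nonneg (by linarith) hn0.le
    have hx1 := peq_le_one (q := q) (K := K n) (P := P n) (hp n)
    have hub := one_sub_prob_le (q := q) hn (hKP n) (hp n) k
    set B := Real.exp k * (((k : ℝ) + α n) ^ (k - 1) * Real.exp (-α n)) with hB
    have hB0 : 0 ≤ B := by positivity
    have hsum : (n : ℝ) * ∑ m ∈ range n, (if m < k then ((n - 1).choose m : ℝ) *
        (peq q (K n) (P n) (p n) ^ m * (1 - peq q (K n) (P n) (p n)) ^ (n - 1 - m)) else 0)
        ≤ k * B := by
      rw [mul_sum]
      calc _ ≤ ∑ m ∈ range n, if m < k then B else 0 := by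
            refine sum_le_sum fun m hm => ?_
            split_ifs with hmk
            · calc _ ≤ (n : ℝ) * (Real.exp k * ((n * peq q (K n) (P n) (p n)) ^ m *
                    Real.exp (-(n * peq q (K n) (P n) (p n))))) :=
                    mul_le_mul_of_nonneg_left
                      (choose_mul_pow_le hmk (mem_range.1 hm) hx0 hx1) hn0.le
                _ = Real.exp k * (n * ((n * peq q (K n) (P n) (p n)) ^ m *
                    Real.exp (-(n * peq q (K n) (P n) (p n))))) := by ring
                _ ≤ B := mul_le_mul_of_nonneg_left (critical_bound hmk hl ha hy)
                    (Real.exp_pos _).le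
            · simp
        _ ≤ k * B := by
            rw [← sum_filter, sum_const, nsmul_eq_mul]
            refine mul_le_mul_of_nonneg_right ?_ hB0
            have : ((range n).filter (· < k)).card ≤ (range k).card :=
              card_le_card fun m hm => by
                rw [mem_filter] at hm
                exact mem_range.2 hm.2
            rw [card_range] at this
            exact_mod_cast this
    have : F (α n) = k * B := rfl
    linarith
  have h1 : Tendsto (fun n => 1 - F (α n)) atTop (nhds 1) := by
    simpa using hF0.const_sub 1
  exact tendsto_of_tendsto_of_tendsto_of_le_of_le' h1 tendsto_const_nhds hlow
    (Eventually.of_forall fun n => prob_le_one (hKP n) (hp n) _)
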